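/- Let q be a complex number with q² ≠ 1 and let n be a nonnegative integer. Then Σ_{k=1}^{n} q^{n²−k²+n−k} · ( [2k²]_q · [2k]_q ) / [2]_q² = ( [n(n+1)]_q / [2]_q )². -/

import Mathlib

open BigOperators Finset

/-- The q-number `[m]_q = (1 - q^m)/(1 - q)`. -/
noncomputable def qNum (q : ℂ) (m : ℕ) : ℂ := (1 - q ^ m) / (1 - q)

theorem q_analogue_cubes_cigler (q : ℂ) (hq : q ^ 2 ≠ 1) (n : ℕ) :
    ∑ k ∈ Finset.Icc 1 n,
        q ^ (n ^ 2 - k ^ 2 + n - k) * (qNum q (2 * k ^ 2) * qNum q (2 * k)) / qNum q 2 ^ 2 =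
      (qNum q (n * (n + 1)) / qNum q 2) ^ 2 := by
  induction n with
  | zero => simp [qNum]
  | succ n ih =>
    rw [Finset.sum_Icc_succ_top (by omega)]
    have h : ∀ k ∈ Finset.Icc 1 n,
        q ^ ((n + 1) ^ 2 - k ^ 2 + (n + 1) - k) * (qNum q (2 * k ^ 2) * qNum q (2 * k))
          / qNum q 2 ^ 2 =
        q ^ (2 * n + 2) * (q ^ (n ^ 2 - k ^ 2 + n - k) * (qNum q (2 * k ^ 2) * qNum q (2 * k))
          / qNum q 2 ^ 2) := by
      intro k hk
      have hk' : k ≤ n := (Finset.mem_Icc.mp hk).2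
      have h2 : k ^ 2 ≤ n ^ 2 := Nat.pow_le_pow_left hk' 2
      have h3 : (n + 1) ^ 2 = n ^ 2 + 2 * n + 1 := by ring
      have e : (n + 1) ^ 2 - k ^ 2 + (n + 1) - k = (2 * n + 2) + (n ^ 2 - k ^ 2 + n - k) := by
        omega
      rw [e, pow_add]
      ring
    rw [Finset.sum_congr rfl h, ← Finset.mul_sum, ih]
    have e0 : (n + 1) ^ 2 - (n + 1) ^ 2 + (n + 1) - (n + 1) = 0 := by omega
    rw [e0]
    simp only [div_pow, mul_div_assoc']
    rw [← add_div]
    congr 1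
    have h1 : (1 - q) ≠ 0 := by
      intro h0
      apply hq
      have : q = 1 := (sub_eq_zero.mp h0).symm
      simp [this]
    simp only [qNum]
    field_simp
    ring
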